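/- arXiv:2405.12025 — 2 statements merged into one kernel-verified Lean document; each statement's English description precedes it below -/
import Mathlib

section
/- Let n ≥ 40 be an integer and let D be an S_{3,1}-free oriented graph on n vertices. Then the number of arcs of D satisfies a(D) ≤ ⌊(n+2)²/4⌋. -/
/-- An oriented graph on `V`: an arc relation in which no two vertices are
joined by arcs in both directions (in particular it is irreflexive). -/
def IsOriented {V : Type*} (A : V → V → Prop) : Prop :=
  ∀ u v : V, A u v → ¬ A v u

/-- The in-degree of `v`: the number of in-neighbours of `v`. -/
noncomputable def inDeg {V : Type*} (A : V → V → Prop) (v : V) : ℕ :=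
  {u : V | A u v}.ncard

/-- The number of arcs of the digraph. -/
noncomputable def arcCount {V : Type*} (A : V → V → Prop) : ℕ :=
  {p : V × V | A p.1 p.2}.ncard

/-- A copy of `S_{k,1}` (the 1-subdivision of the in-star of order `k+1`)
centered at `v`: pairwise distinct vertices `v, u 0, …, u (k-1), w 0, …, w (k-1)`
with arcs `w i → u i` and `u i → v`. -/
def HasSCopyAt {V : Type*} (A : V → V → Prop) (k : ℕ) (v : V) : Prop :=
  ∃ u w : Fin k → V,
    Function.Injective u ∧ Function.Injective w ∧
    (∀ i j : Fin k, u i ≠ w j) ∧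
    (∀ i : Fin k, u i ≠ v) ∧ (∀ i : Fin k, w i ≠ v) ∧
    (∀ i : Fin k, A (w i) (u i)) ∧ (∀ i : Fin k, A (u i) v)

/-- `A` is `S_{k,1}`-free: no copy of `S_{k,1}` with any center. -/
def SFree {V : Type*} (A : V → V → Prop) (k : ℕ) : Prop :=
  ∀ v : V, ¬ HasSCopyAt A k v

namespace S31

open Finset

variable {V : Type*} [Fintype V]

open scoped Classical in
/-- The finset of in-neighbours. -/
noncomputable def inN (A : V → V → Prop) (v : V) : Finset V := univ.filter (fun u => A u v)

open scoped Classical in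
/-- Heavy vertices: in-degree at least 5. -/
noncomputable def Kf (A : V → V → Prop) : Finset V := univ.filter (fun v => 5 ≤ (inN A v).card)

open scoped Classical in
/-- Light vertices: in-degree at most 4. -/
noncomputable def Lf (A : V → V → Prop) : Finset V := univ.filter (fun v => ¬ 5 ≤ (inN A v).card)

open scoped Classical in
/-- Number of heavy out-neighbours. -/
noncomputable def del (A : V → V → Prop) (l : V) : ℕ := ((Kf A).filter (fun k => A l k)).card

open scoped Classical in
/-- Light in-neighbours. -/
noncomputable def LN (A : V → V → Prop) (l : V) : Finset V := (Lf A).filter (fun u => A u l)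

open scoped Classical in
/-- Heavy in-neighbours. -/
noncomputable def KN (A : V → V → Prop) (l : V) : Finset V := (Kf A).filter (fun u => A u l)

/-- The contribution of a light vertex. -/
noncomputable def val (A : V → V → Prop) (l : V) : ℕ := del A l + (inN A l).card

variable {A : V → V → Prop}

lemma mem_inN {u v : V} : u ∈ inN A v ↔ A u v := by simp [inN]
lemma mem_Kf {v : V} : v ∈ Kf A ↔ 5 ≤ (inN A v).card := by simp [Kf]
lemma mem_Lf {v : V} : v ∈ Lf A ↔ ¬ 5 ≤ (inN A v).card := by simp [Lf]
lemma mem_LN {u v : V} : u ∈ LN A v ↔ u ∈ Lf A ∧ A u v := by simp [LN]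
lemma mem_KN {u v : V} : u ∈ KN A v ↔ u ∈ Kf A ∧ A u v := by simp [KN]

lemma ne_KL {x y : V} (hx : x ∈ Kf A) (hy : y ∈ Lf A) : x ≠ y := by
  rintro rfl; exact mem_Lf.1 hy (mem_Kf.1 hx)

lemma pick {T S : Finset V} {c : ℕ} (hS : S.card ≤ c) (hT : c < T.card) : ∃ w ∈ T, w ∉ S :=
  Finset.exists_mem_notMem_of_card_lt_card (lt_of_le_of_lt hS hT)

/-- No three disjoint arcs into the in-neighbourhood of `k`. -/
lemma no3 (ho : IsOriented A) (hf : SFree A 3) {k u1 u2 u3 w1 w2 w3 : V}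
    (h1 : A u1 k) (h2 : A u2 k) (h3 : A u3 k)
    (g1 : A w1 u1) (g2 : A w2 u2) (g3 : A w3 u3)
    (a1 : u1 ≠ u2) (a2 : u1 ≠ u3) (a3 : u2 ≠ u3)
    (b1 : w1 ≠ w2) (b2 : w1 ≠ w3) (b3 : w2 ≠ w3)
    (c12 : u1 ≠ w2) (c13 : u1 ≠ w3) (c21 : u2 ≠ w1) (c23 : u2 ≠ w3)
    (c31 : u3 ≠ w1) (c32 : u3 ≠ w2) : False := by
  have irr : ∀ {x y}, A x y → x ≠ y := by
    rintro x y h rfl; exact ho _ _ h h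
  have tw : ∀ {w u}, A w u → A u k → w ≠ k := by
    rintro w u h h' rfl; exact ho _ _ h h'
  apply hf k
  refine ⟨![u1, u2, u3], ![w1, w2, w3], ?_, ?_, ?_, ?_, ?_, ?_, ?_⟩
  · intro i j hij; fin_cases i <;> fin_cases j <;> simp_all
  · intro i j hij; fin_cases i <;> fin_cases j <;> simp_all
  · intro i j
    have := irr g1; have := irr g2; have := irr g3
    fin_cases i <;> fin_cases j <;> simp <;> first | assumption | (apply Ne.symm; assumption)
  · intro i; fin_cases i
    · exact irr h1
    · exact irr h2
    · exact irr h3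
  · intro i; fin_cases i
    · exact tw g1 h1
    · exact tw g2 h2
    · exact tw g3 h3
  · intro i; fin_cases i <;> assumption
  · intro i; fin_cases i <;> assumption

lemma noH1 (ho : IsOriented A) (hf : SFree A 3) {k x u1 u2 w1 w2 : V}
    (hx : x ∈ Kf A) (hxk : A x k) (h1 : A u1 k) (h2 : A u2 k)
    (g1 : A w1 u1) (g2 : A w2 u2) (a1 : u1 ≠ u2) (b1 : w1 ≠ w2)
    (c12 : u1 ≠ w2) (c21 : u2 ≠ w1)
    (d1 : x ≠ u1) (d2 : x ≠ u2) (d3 : x ≠ w1) (d4 : x ≠ w2) : False := by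
  classical
  obtain ⟨w, hw, hn⟩ := pick (T := inN A x) (S := {u1, u2, w1, w2}) (c := 4)
    Finset.card_le_four (mem_Kf.1 hx)
  simp only [mem_insert, mem_singleton, not_or] at hn
  obtain ⟨n1, n2, n3, n4⟩ := hn
  exact no3 ho hf h1 h2 hxk g1 g2 (mem_inN.1 hw) a1 d1.symm d2.symm b1 (Ne.symm n3) (Ne.symm n4)
    c12 (Ne.symm n1) c21 (Ne.symm n2) d3 d4

lemma noH2 (ho : IsOriented A) (hf : SFree A 3) {k x y u w : V}
    (hx : x ∈ Kf A) (hy : y ∈ Kf A) (hxy : x ≠ y) (hxk : A x k) (hyk : A y k) (h1 : A u k)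
    (g1 : A w u) (d1 : x ≠ u) (d2 : x ≠ w) (d3 : y ≠ u) (d4 : y ≠ w) : False := by
  classical
  obtain ⟨z, hz, hn⟩ := pick (T := inN A y) (S := {u, w, x}) (c := 4)
    (Finset.card_le_three.trans (by norm_num)) (mem_Kf.1 hy)
  simp only [mem_insert, mem_singleton, not_or] at hn
  obtain ⟨n1, n2, n3⟩ := hn
  exact noH1 ho hf hx hxk h1 hyk g1 (mem_inN.1 hz) d3.symm (Ne.symm n2) (Ne.symm n1) d4
    d1 hxy d2 (Ne.symm n3)

lemma KN_le (ho : IsOriented A) (hf : SFree A 3) (k : V) : (KN A k).card ≤ 2 := by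
  classical
  by_contra hc
  obtain ⟨x, y, z, hx, hy, hz, xy, xz, yz⟩ := Finset.two_lt_card_iff.1 (not_le.1 hc)
  rw [mem_KN] at hx hy hz
  obtain ⟨w, hw, hn⟩ := pick (T := inN A z) (S := {x, y}) (c := 4)
    (Finset.card_le_two.trans (by norm_num)) (mem_Kf.1 hz.1)
  simp only [mem_insert, mem_singleton, not_or] at hn
  exact noH2 ho hf hx.1 hy.1 xy hx.2 hy.2 hz.2 (mem_inN.1 hw) xz (Ne.symm hn.1) yz (Ne.symm hn.2)

/-- With a heavy in-neighbour `x`, two other in-neighbours cannot both have two in-neighbours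
different from `x`. -/
lemma noPair (ho : IsOriented A) (hf : SFree A 3) {k x l m : V}
    (hx : x ∈ Kf A) (hxk : A x k) (hl : A l k) (hm : A m k) (hlm : l ≠ m)
    (xl : x ≠ l) (xm : x ≠ m) {S T : Finset V} (hS : ∀ w ∈ S, A w l ∧ x ≠ w)
    (hT : ∀ w ∈ T, A w m ∧ x ≠ w) (cS : 2 ≤ S.card) (cT : 2 ≤ T.card) : False := by
  classical
  by_cases h : A m l
  · obtain ⟨w, hw, hn⟩ := pick (T := S) (S := {m}) (c := 1) (by simp) cS
    obtain ⟨z, hz, hn'⟩ := pick (T := T) (S := {w}) (c := 1) (by simp) cT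
    simp only [mem_singleton] at hn hn'
    refine noH1 ho hf hx hxk hl hm (hS w hw).1 (hT z hz).1 hlm (Ne.symm hn') ?_ (Ne.symm hn)
      xl xm (hS w hw).2 (hT z hz).2
    rintro rfl; exact ho _ _ h (hT _ hz).1
  · obtain ⟨w, hw, hn⟩ := pick (T := T) (S := {l}) (c := 1) (by simp) cT
    obtain ⟨z, hz, hn'⟩ := pick (T := S) (S := {w}) (c := 1) (by simp) cS
    simp only [mem_singleton] at hn hn'
    refine noH1 ho hf hx hxk hl hm (hS z hz).1 (hT w hw).1 hlm hn' (Ne.symm hn) ?_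
      xl xm (hS z hz).2 (hT w hw).2
    rintro rfl; exact h (hS _ hz).1

lemma noAcyc (ho : IsOriented A) (hf : SFree A 3) {k a b c : V}
    (ha : A a k) (hb : A b k) (hc : A c k) (ab : a ≠ b) (ac : a ≠ c) (bc : b ≠ c)
    (ca : 3 ≤ (inN A a).card) (cb : 3 ≤ (inN A b).card) (cc : 3 ≤ (inN A c).card)
    (h1 : ¬ A b a) (h2 : ¬ A c a) (h3 : ¬ A c b) : False := by
  classical
  obtain ⟨w, hw, hn⟩ := pick (T := inN A c) (S := {a, b}) (c := 2) Finset.card_le_two cc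
  obtain ⟨z, hz, hn'⟩ := pick (T := inN A b) (S := {a, w}) (c := 2) Finset.card_le_two cb
  obtain ⟨y, hy, hn''⟩ := pick (T := inN A a) (S := {z, w}) (c := 2) Finset.card_le_two ca
  simp only [mem_insert, mem_singleton, not_or] at hn hn' hn''
  rw [mem_inN] at hw hz hy
  refine no3 ho hf ha hb hc hy hz hw ab ac bc hn''.1 hn''.2 hn'.2 (Ne.symm hn'.1) (Ne.symm hn.1)
    ?_ (Ne.symm hn.2) ?_ ?_
  · rintro rfl; exact h1 hy
  · rintro rfl; exact h2 hy
  · rintro rfl; exact h3 hz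

lemma no4 (ho : IsOriented A) (hf : SFree A 3) {k : V} {F : Finset V} (hF : 4 ≤ F.card)
    (hk : ∀ l ∈ F, A l k) (hd : ∀ l ∈ F, 3 ≤ (inN A l).card) : False := by
  classical
  obtain ⟨G, hG, hc⟩ := Finset.exists_subset_card_eq hF
  obtain ⟨a, b, c, d, ab, ac, ad, bc, bd, cd, rfl⟩ := Finset.card_eq_four.1 hc
  have H : ∀ x y z, x ∈ ({a, b, c, d} : Finset V) → y ∈ ({a, b, c, d} : Finset V) →
      z ∈ ({a, b, c, d} : Finset V) → x ≠ y → x ≠ z → y ≠ z → ¬ A y x → ¬ A z x → ¬ A z y →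
      False := by
    intro x y z hx hy hz xy xz yz h1 h2 h3
    exact noAcyc ho hf (hk x (hG hx)) (hk y (hG hy)) (hk z (hG hz)) xy xz yz
      (hd x (hG hx)) (hd y (hG hy)) (hd z (hG hz)) h1 h2 h3
  have ma : a ∈ ({a, b, c, d} : Finset V) := by simp
  have mb : b ∈ ({a, b, c, d} : Finset V) := by simp
  have mc : c ∈ ({a, b, c, d} : Finset V) := by simp
  have md : d ∈ ({a, b, c, d} : Finset V) := by simp
  have o1 := ho a b
  have o2 := ho a c
  have o3 := ho a d
  have o4 := ho b c
  have o5 := ho b d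
  have o6 := ho c d
  have T : ∀ x y z, x ∈ ({a, b, c, d} : Finset V) → y ∈ ({a, b, c, d} : Finset V) →
      z ∈ ({a, b, c, d} : Finset V) → x ≠ y → x ≠ z → y ≠ z →
      (A x y ∧ A y z ∧ A z x) ∨ (A y x ∧ A z y ∧ A x z) := by
    intro x y z hx hy hz xy xz yz
    have e1 := H x y z hx hy hz xy xz yz
    have e2 := H x z y hx hz hy xz xy yz.symm
    have e3 := H y x z hy hx hz xy.symm yz xz
    have e4 := H y z x hy hz hx yz xy.symm xz.symm
    have e5 := H z x y hz hx hy xz.symm yz.symm xy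
    have e6 := H z y x hz hy hx yz.symm xz.symm xy.symm
    have p1 := ho x y
    have p2 := ho y z
    have p3 := ho x z
    clear o1 o2 o3 o4 o5 o6 H hd hk ma mb mc md hG hc hx hy hz xy xz yz
    by_cases h1 : A x y <;> by_cases h2 : A y z <;> by_cases h3 : A x z <;>
      by_cases h4 : A y x <;> by_cases h5 : A z y <;> by_cases h6 : A z x <;> simp_all
  have t1 := T a b c ma mb mc ab ac bc
  have t2 := T a b d ma mb md ab ad bd
  have t3 := T a c d ma mc md ac ad cd
  clear T H hd hk ma mb mc md hG hc
  grind

/-- Common heavy out-neighbour. -/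
lemma common {F S : Finset V} {c : ℕ} (hS : S ⊆ Kf A)
    (hF : ∀ l ∈ F, (Kf A).card ≤ del A l + c) (h : F.card * c < S.card) :
    ∃ k ∈ S, ∀ l ∈ F, A l k := by
  classical
  by_contra hcon
  push Not at hcon
  have hsub : S ⊆ F.biUnion (fun l => (Kf A).filter (fun k => ¬ A l k)) := by
    intro k hk
    obtain ⟨l, hl, hlk⟩ := hcon k hk
    simp only [mem_biUnion, mem_filter]
    exact ⟨l, hl, hS hk, hlk⟩
  have h1 := Finset.card_le_card hsub
  have h2 := Finset.card_biUnion_le_card_mul F (fun l => (Kf A).filter (fun k => ¬ A l k)) c (by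
    intro l hl
    have := hF l hl
    have e := Finset.card_filter_add_card_filter_not (s := Kf A) (fun k => A l k)
    unfold del at this
    omega)
  omega

lemma deg_split (v : V) : (inN A v).card = (LN A v).card + (KN A v).card := by
  classical
  have e := Finset.card_filter_add_card_filter_not (s := inN A v) (fun u => 5 ≤ (inN A u).card)
  have e1 : (inN A v).filter (fun u => 5 ≤ (inN A u).card) = KN A v := by
    ext u; simp [mem_inN, mem_KN, mem_Kf, and_comm]
  have e2 : (inN A v).filter (fun u => ¬ 5 ≤ (inN A u).card) = LN A v := by
    ext u; simp only [mem_filter, mem_inN, mem_LN, mem_Lf, and_comm]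
  rw [e1, e2] at e
  omega

lemma val_le (ho : IsOriented A) (l : V) : val A l ≤ (Kf A).card + (LN A l).card := by
  classical
  have h : del A l + (KN A l).card ≤ (Kf A).card := by
    unfold del
    rw [← Finset.card_union_of_disjoint]
    · apply Finset.card_le_card
      intro x; simp only [mem_union, mem_filter, mem_KN]; tauto
    · rw [Finset.disjoint_left]
      intro x hx hx'
      exact ho _ _ (mem_filter.1 hx).2 (mem_KN.1 hx').2
  have := deg_split (A := A) l
  unfold val; omega

lemma light_le {l : V} (h : l ∈ Lf A) : (inN A l).card ≤ 4 := by
  have := mem_Lf.1 h; omega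

lemma del_le (l : V) : del A l ≤ (Kf A).card := by classical exact Finset.card_filter_le _ _

lemma card_KL : (Kf A).card + (Lf A).card = Fintype.card V := by
  classical
  exact Finset.card_filter_add_card_filter_not (s := (univ : Finset V)) _

lemma arc_eq : arcCount A = ∑ l ∈ Lf A, val A l + ∑ k ∈ Kf A, (KN A k).card := by
  classical
  have h1 : arcCount A = ∑ v : V, (inN A v).card := by
    unfold arcCount
    rw [Set.ncard_eq_toFinset_card']
    have : ({p : V × V | A p.1 p.2}).toFinset = (univ : Finset (V × V)).filter (fun p => A p.1 p.2) := by
      ext p; simp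
    rw [this, Finset.card_filter, Fintype.sum_prod_type_right]
    refine Finset.sum_congr rfl fun v _ => ?_
    rw [inN, Finset.card_filter]
  have h2 : ∑ v : V, (inN A v).card = ∑ v ∈ Kf A, (inN A v).card + ∑ v ∈ Lf A, (inN A v).card :=
    (Finset.sum_filter_add_sum_filter_not univ _ _).symm
  have h3 : ∑ v ∈ Lf A, del A v = ∑ v ∈ Kf A, (LN A v).card := by
    have := Finset.sum_card_bipartiteAbove_eq_sum_card_bipartiteBelow (s := Lf A) (t := Kf A) A
    simpa [Finset.bipartiteAbove, Finset.bipartiteBelow, del, LN] using this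
  have h4 : ∑ v ∈ Kf A, (inN A v).card
      = ∑ v ∈ Kf A, (LN A v).card + ∑ v ∈ Kf A, (KN A v).card := by
    rw [← Finset.sum_add_distrib]
    exact Finset.sum_congr rfl fun v _ => deg_split v
  have h5 : ∑ v ∈ Lf A, val A v = ∑ v ∈ Lf A, del A v + ∑ v ∈ Lf A, (inN A v).card := by
    rw [← Finset.sum_add_distrib]; rfl
  omega

open scoped Classical in
/-- Light vertices of contribution at least `K + 2`. -/
noncomputable def Qf (A : V → V → Prop) : Finset V :=
  (Lf A).filter (fun l => (Kf A).card + 2 ≤ val A l)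

open scoped Classical in
/-- Light vertices of contribution at least `K + 3`. -/
noncomputable def Rf (A : V → V → Prop) : Finset V :=
  (Lf A).filter (fun l => (Kf A).card + 3 ≤ val A l)

lemma mem_Qf {l : V} : l ∈ Qf A ↔ l ∈ Lf A ∧ (Kf A).card + 2 ≤ val A l := by simp [Qf]
lemma mem_Rf {l : V} : l ∈ Rf A ↔ l ∈ Lf A ∧ (Kf A).card + 3 ≤ val A l := by simp [Rf]

lemma val_del {l : V} (h : l ∈ Lf A) : val A l ≤ del A l + 4 := by
  have := light_le h; unfold val; omega

lemma Q_del {l : V} (h : l ∈ Qf A) : (Kf A).card ≤ del A l + 2 := by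
  have h := mem_Qf.1 h
  have := val_del h.1; omega

lemma Q_LN (ho : IsOriented A) {l : V} (h : l ∈ Qf A) : 2 ≤ (LN A l).card := by
  have h := mem_Qf.1 h
  have := val_le ho l; omega

lemma R_LN (ho : IsOriented A) {l : V} (h : l ∈ Rf A) : 3 ≤ (LN A l).card := by
  have h := mem_Rf.1 h
  have := val_le ho l; omega

lemma R_sub {l : V} (h : l ∈ Rf A) : l ∈ Qf A := by
  have h := mem_Rf.1 h
  exact mem_Qf.2 ⟨h.1, by omega⟩

lemma LN_le (v : V) : (LN A v).card ≤ (inN A v).card := by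
  have := deg_split (A := A) v; omega

lemma irr (ho : IsOriented A) {x y : V} (h : A x y) : x ≠ y := by
  rintro rfl; exact ho _ _ h h

lemma common3 {l m p : V} (hK : 11 ≤ (Kf A).card) (hl : l ∈ Qf A) (hm : m ∈ Qf A)
    (hp : p ∈ Qf A) : ∃ k, A l k ∧ A m k ∧ A p k := by
  classical
  obtain ⟨k, -, hk⟩ := common (A := A) (F := {l, m, p}) (S := Kf A) (c := 2) (Finset.Subset.refl _)
    (by
      intro x hx
      simp only [mem_insert, mem_singleton] at hx
      rcases hx with rfl | rfl | rfl <;> apply Q_del <;> assumption)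
    (by
      have : ({l, m, p} : Finset V).card ≤ 3 := Finset.card_le_three
      omega)
  exact ⟨k, hk l (by simp), hk m (by simp), hk p (by simp)⟩

/-- Structure around a vertex of `R` when `Q` is large. -/
lemma struct (ho : IsOriented A) (hf : SFree A 3) (hK : 11 ≤ (Kf A).card)
    (hQ : 15 ≤ (Qf A).card) {r : V} (hr : r ∈ Rf A) :
    ∃ y, (∀ r' ∈ Rf A, r' = r ∨ r' = y) ∧ (∀ w ∈ LN A r, w ∈ Qf A → w = y) := by
  classical
  have hrQ := R_sub hr
  have hrL := (mem_Rf.1 hr).1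
  set Q' := Qf A \ insert r (inN A r) with hQ'
  have cQ' : 10 ≤ Q'.card := by
    have h1 : _ ≤ Q'.card := Finset.le_card_sdiff (insert r (inN A r)) (Qf A)
    have h2 := Finset.card_insert_le r (inN A r)
    have h3 := light_le hrL
    omega
  have mQ' : ∀ {l}, l ∈ Q' → l ∈ Qf A ∧ l ≠ r ∧ ¬ A l r := by
    intro l hl
    simpa [hQ', mem_sdiff, mem_inN] using hl
  have pair : ∀ l m u v, l ∈ Q' → m ∈ Q' → l ≠ m → u ∈ LN A l → v ∈ LN A m → u ≠ r → v ≠ r →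
      u ≠ m → v ≠ l → u ≠ v → False := by
    intro l m u v hl hm lm hu hv ur vr um vl uv
    obtain ⟨z, hz, hn⟩ := pick (T := LN A r) (S := {u, v}) (c := 2) Finset.card_le_two (R_LN ho hr)
    simp only [mem_insert, mem_singleton, not_or] at hn
    obtain ⟨k, k1, k2, k3⟩ := common3 hK (mQ' hl).1 (mQ' hm).1 hrQ
    rw [mem_LN] at hz hu hv
    refine no3 ho hf k1 k2 k3 hu.2 hv.2 hz.2 lm (mQ' hl).2.1 (mQ' hm).2.1 uv (Ne.symm hn.1)
      (Ne.symm hn.2) vl.symm ?_ um.symm ?_ ur.symm vr.symm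
    · rintro rfl; exact (mQ' hl).2.2 hz.2
    · rintro rfl; exact (mQ' hm).2.2 hz.2
  have ex : ∀ l, l ∈ Q' → ∃ u, u ∈ LN A l ∧ u ≠ r := by
    intro l hl
    obtain ⟨u, hu, hn⟩ := pick (T := LN A l) (S := {r}) (c := 1) (by simp) (Q_LN ho (mQ' hl).1)
    exact ⟨u, hu, by simpa using hn⟩
  choose! f hfm hfr using ex
  obtain ⟨l1, hl1⟩ : Q'.Nonempty := Finset.card_pos.1 (by omega)
  set X := Q' \ {l1, f l1} with hX
  have cX : 8 ≤ X.card := by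
    have h1 : _ ≤ X.card := Finset.le_card_sdiff {l1, f l1} Q'
    have h2 : ({l1, f l1} : Finset V).card ≤ 2 := Finset.card_le_two
    omega
  have fX : ∀ l ∈ X, f l = l1 ∨ f l = f l1 := by
    intro l hl
    simp only [hX, mem_sdiff, mem_insert, mem_singleton, not_or] at hl
    by_contra hcon
    push Not at hcon
    exact pair l l1 (f l) (f l1) hl.1 hl1 hl.2.1 (hfm l hl.1) (hfm l1 hl1) (hfr l hl.1)
      (hfr l1 hl1) hcon.1 (Ne.symm hl.2.2) hcon.2
  obtain ⟨y, hyr, M, hM, cM⟩ : ∃ y, y ≠ r ∧ ∃ M ⊆ Q', (∀ l ∈ M, y ∈ LN A l) ∧ 4 ≤ M.card := by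
    have hs := Finset.card_filter_add_card_filter_not (s := X) (fun l => f l = l1)
    have XQ : ∀ l ∈ X, l ∈ Q' := fun l hl => (mem_sdiff.1 hl).1
    by_cases h : 4 ≤ (X.filter (fun l => f l = l1)).card
    · refine ⟨l1, (mQ' hl1).2.1, _, ?_, ?_, h⟩
      · intro l hl; exact XQ l (mem_filter.1 hl).1
      · intro l hl
        have hl := mem_filter.1 hl
        rw [← hl.2]; exact hfm l (XQ l hl.1)
    · refine ⟨f l1, hfr l1 hl1, X.filter (fun l => ¬ f l = l1), ?_, ?_, by omega⟩
      · intro l hl; exact XQ l (mem_filter.1 hl).1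
      · intro l hl
        have hl := mem_filter.1 hl
        rw [← (fX l hl.1).resolve_left hl.2]; exact hfm l (XQ l hl.1)
  obtain ⟨hMy, cM⟩ := (⟨cM.1, cM.2⟩ : (∀ l ∈ M, y ∈ LN A l) ∧ 4 ≤ M.card)
  have only : ∀ l ∈ Q', l ≠ y → ∀ u ∈ LN A l, u = r ∨ u = y := by
    intro l hl ly u hu
    by_contra hcon
    push Not at hcon
    obtain ⟨m, hm, hn⟩ := pick (T := M) (S := {l, u}) (c := 2) Finset.card_le_two (by omega)
    simp only [mem_insert, mem_singleton, not_or] at hn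
    exact pair l m u y hl (hM hm) (Ne.symm hn.1) hu (hMy m hm) hcon.1 hyr (Ne.symm hn.2)
      ly.symm hcon.2
  have both : ∀ l ∈ Q', l ≠ y → A r l ∧ A y l := by
    intro l hl ly
    have h2 := Q_LN ho (mQ' hl).1
    constructor
    · obtain ⟨u, hu, hn⟩ := pick (T := LN A l) (S := {y}) (c := 1) (by simp) h2
      have := (only l hl ly u hu).resolve_right (by simpa using hn)
      subst this; exact (mem_LN.1 hu).2
    · obtain ⟨u, hu, hn⟩ := pick (T := LN A l) (S := {r}) (c := 1) (by simp) h2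
      have := (only l hl ly u hu).resolve_left (by simpa using hn)
      subst this; exact (mem_LN.1 hu).2
  have third : ∀ w ∈ Qf A, w ≠ r → w ≠ y → ∀ c ∈ LN A w, c ≠ r → c ≠ y → False := by
    intro w hw wr wy c hc cr cy
    obtain ⟨l, hl, hn⟩ := pick (T := Q') (S := {c, w, y}) (c := 3) Finset.card_le_three (by omega)
    obtain ⟨m, hm, hn'⟩ := pick (T := Q') (S := {c, w, y, l}) (c := 4) Finset.card_le_four
      (by omega)
    simp only [mem_insert, mem_singleton, not_or] at hn hn'
    obtain ⟨k, k1, k2, k3⟩ := common3 hK hw (mQ' hl).1 (mQ' hm).1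
    exact no3 ho hf k1 k2 k3 (mem_LN.1 hc).2 (both l hl hn.2.2).1 (both m hm hn'.2.2.1).2
      (Ne.symm hn.2.1) (Ne.symm hn'.2.1) (Ne.symm hn'.2.2.2) cr cy hyr.symm wr wy hn.1 hn.2.2
      hn'.1 (mQ' hm).2.1
  refine ⟨y, ?_, ?_⟩
  · intro r' hr'
    by_contra hcon
    push Not at hcon
    obtain ⟨c, hc, hn⟩ := pick (T := LN A r') (S := {r, y}) (c := 2) Finset.card_le_two
      (R_LN ho hr')
    simp only [mem_insert, mem_singleton, not_or] at hn
    exact third r' (R_sub hr') hcon.1 hcon.2 c hc hn.1 hn.2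
  · intro w hw hwQ
    by_contra wy
    obtain ⟨c, hc, hn⟩ := pick (T := LN A w) (S := {y}) (c := 1) (by simp) (Q_LN ho hwQ)
    have hwr := (mem_LN.1 hw).2
    refine third w hwQ (irr ho hwr) wy c hc ?_ (by simpa using hn)
    rintro rfl; exact ho _ _ hwr (mem_LN.1 hc).2

lemma sumb (F : Finset V) (f : V → ℕ) (c d e : ℕ) (p q r : V → Prop) [DecidablePred p]
    [DecidablePred q] [DecidablePred r]
    (h : ∀ l ∈ F, f l + (if p l then 1 else 0) ≤ c + (if q l then d else 0)
      + (if r l then e else 0)) :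
    ∑ l ∈ F, f l + (F.filter p).card ≤ F.card * c + (F.filter q).card * d
      + (F.filter r).card * e := by
  have := Finset.sum_le_sum h
  simpa [Finset.sum_add_distrib, ← Finset.sum_filter] using this

lemma filter_eq_le (F : Finset V) (r : V) [DecidablePred (fun l => l = r)] :
    (F.filter (fun l => l = r)).card ≤ 1 := by
  rw [Finset.card_le_one]
  intro a ha b hb
  rw [(mem_filter.1 ha).2, (mem_filter.1 hb).2]

lemma R_le (ho : IsOriented A) (hf : SFree A 3) (hK : 11 ≤ (Kf A).card) : (Rf A).card ≤ 3 := by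
  classical
  by_contra hc
  obtain ⟨F, hF, cF⟩ := Finset.exists_subset_card_eq (show 4 ≤ (Rf A).card by omega)
  obtain ⟨k, -, hk⟩ := common (A := A) (F := F) (S := Kf A) (c := 2) (Finset.Subset.refl _)
    (fun l hl => Q_del (R_sub (hF hl))) (by omega)
  exact no4 ho hf cF.ge hk (fun l hl => (R_LN ho (hF hl)).trans (LN_le l))

/-- Sum bound when `Q` is large. -/
lemma sum_large (ho : IsOriented A) (hf : SFree A 3) (hK : 11 ≤ (Kf A).card)
    (hQ : 15 ≤ (Qf A).card) : ∑ l ∈ Lf A, val A l ≤ (Lf A).card * ((Kf A).card + 2) := by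
  classical
  by_cases hR : Rf A = ∅
  · rw [← smul_eq_mul]
    apply Finset.sum_le_card_nsmul
    intro l hl
    by_contra hc
    have : l ∈ Rf A := mem_Rf.2 ⟨hl, by omega⟩
    simp [hR] at this
  obtain ⟨r, hr⟩ := Finset.nonempty_iff_ne_empty.2 hR
  have hr4 := (LN_le r).trans (light_le (mem_Rf.1 hr).1)
  have hr3 := R_LN ho hr
  have Dsub : ∀ {x : V} {S : Finset V}, S ⊆ LN A x → (∀ w ∈ S, w ∉ Qf A) →
      S.card ≤ ((Lf A).filter (fun l => l ∉ Qf A)).card := by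
    intro x S hS hSQ
    apply Finset.card_le_card
    intro w hw
    exact mem_filter.2 ⟨(mem_LN.1 (hS hw)).1, hSQ w hw⟩
  have gen : ∀ y, (∀ r' ∈ Rf A, r' = r ∨ r' = y) → ∀ l ∈ Lf A, l ∈ Rf A → l = r ∨ l = y :=
    fun y h l _ hl => h l hl
  obtain ⟨y, hy1, hy2⟩ := struct ho hf hK hQ hr
  by_cases hyR : y ∈ Rf A ∧ y ≠ r
  · obtain ⟨hyR, yr⟩ := hyR
    have hy4 := (LN_le y).trans (light_le (mem_Rf.1 hyR).1)
    have hy3 := R_LN ho hyR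
    obtain ⟨z, hz1, hz2⟩ := struct ho hf hK hQ hyR
    have zr : r = z := (hz1 r hr).resolve_left yr.symm
    subst zr
    have hs := sumb (Lf A) (val A) ((Kf A).card + 2) ((LN A r).card - 2) ((LN A y).card - 2)
      (fun l => l ∉ Qf A) (fun l => l = r) (fun l => l = y) (by
        intro l hl
        have hv := val_le ho l
        by_cases h1 : l = r
        · subst h1
          simp only [R_sub hr, not_true, if_false, if_true]
          omega
        by_cases h2 : l = y
        · subst h2
          simp only [R_sub hyR, not_true, if_false, if_true]
          omega
        have hlR : l ∉ Rf A := fun h => (hy1 l h).elim h1 h2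
        rw [mem_Rf] at hlR
        by_cases hlQ : l ∈ Qf A
        · simp only [hlQ, not_true, if_false, h1, h2]
          by_contra hc; exact hlR ⟨hl, by omega⟩
        · simp only [hlQ, not_false_eq_true, if_false, h1, h2, if_true]
          rw [mem_Qf] at hlQ
          by_contra hc; exact hlQ ⟨hl, by omega⟩)
    have c1 := filter_eq_le (Lf A) r
    have c2 := filter_eq_le (Lf A) y
    have c1' := Nat.mul_le_mul_right ((LN A r).card - 2) c1
    have c2' := Nat.mul_le_mul_right ((LN A y).card - 2) c2
    have hD : (LN A r).card ≤ ((Lf A).filter (fun l => l ∉ Qf A)).card ∨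
        (LN A y).card ≤ ((Lf A).filter (fun l => l ∉ Qf A)).card := by
      by_cases h : A y r
      · right
        refine Dsub (Finset.Subset.refl _) ?_
        intro w hw hwQ
        have := hz2 w hw hwQ
        subst this
        exact ho _ _ h (mem_LN.1 hw).2
      · left
        refine Dsub (Finset.Subset.refl _) ?_
        intro w hw hwQ
        have := hy2 w hw hwQ
        subst this
        exact h (mem_LN.1 hw).2
    omega
  · have hs := sumb (Lf A) (val A) ((Kf A).card + 2) ((LN A r).card - 2) 0
      (fun l => l ∉ Qf A) (fun l => l = r) (fun l => l = y) (by
        intro l hl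
        have hv := val_le ho l
        by_cases h1 : l = r
        · subst h1
          simp only [R_sub hr, not_true, if_false, if_true]
          omega
        have hlR : l ∉ Rf A := by
          intro h
          have := (hy1 l h).resolve_left h1
          subst this
          exact hyR ⟨h, h1⟩
        rw [mem_Rf] at hlR
        by_cases hlQ : l ∈ Qf A
        · simp only [hlQ, not_true, if_false, h1]
          by_contra hc; exact hlR ⟨hl, by omega⟩
        · simp only [hlQ, not_false_eq_true, if_false, h1, if_true]
          rw [mem_Qf] at hlQ
          by_contra hc; exact hlQ ⟨hl, by omega⟩)
    have c1 := filter_eq_le (Lf A) r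
    have c1' := Nat.mul_le_mul_right ((LN A r).card - 2) c1
    have hD : ((LN A r).erase y).card ≤ ((Lf A).filter (fun l => l ∉ Qf A)).card := by
      refine Dsub (Finset.erase_subset _ _) ?_
      intro w hw hwQ
      exact (Finset.mem_erase.1 hw).1 (hy2 w (Finset.mem_erase.1 hw).2 hwQ)
    have := Finset.pred_card_le_card_erase (s := LN A r) (a := y)
    omega

/-- Sum bound in terms of `Q` and `R`. -/
lemma sum_QR (ho : IsOriented A) : ∑ l ∈ Lf A, val A l ≤
    (Lf A).card * ((Kf A).card + 1) + (Qf A).card + 2 * (Rf A).card := by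
  classical
  have hs := sumb (Lf A) (val A) ((Kf A).card + 1) 1 2 (fun _ => False)
      (fun l => (Kf A).card + 2 ≤ val A l) (fun l => (Kf A).card + 3 ≤ val A l) (by
    intro l hl
    have h1 := val_del hl
    have h2 := del_le (A := A) l
    simp only [if_false]
    split_ifs <;> omega)
  have e1 : ((Lf A).filter (fun l => (Kf A).card + 2 ≤ val A l)).card = (Qf A).card := by
    rfl
  have e2 : ((Lf A).filter (fun l => (Kf A).card + 3 ≤ val A l)).card = (Rf A).card := by
    rfl
  rw [e1, e2] at hs
  omega

lemma R_le_Q : (Rf A).card ≤ (Qf A).card := Finset.card_le_card fun _ h => R_sub h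

/-- A vertex with a heavy in-neighbour is dominated by at most one vertex of `Q`. -/
lemma Q_one (ho : IsOriented A) (hf : SFree A 3) {k l m : V} (hk : 1 ≤ (KN A k).card)
    (hl : l ∈ Qf A) (hm : m ∈ Qf A) (hlm : l ≠ m) (lk : A l k) (mk : A m k) : False := by
  obtain ⟨x, hx⟩ := Finset.card_pos.1 hk
  rw [mem_KN] at hx
  refine noPair ho hf hx.1 hx.2 lk mk hlm (ne_KL hx.1 (mem_Qf.1 hl).1) (ne_KL hx.1 (mem_Qf.1 hm).1)
    (S := LN A l) (T := LN A m) ?_ ?_ (Q_LN ho hl) (Q_LN ho hm)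
  · intro w hw; rw [mem_LN] at hw; exact ⟨hw.2, ne_KL hx.1 hw.1⟩
  · intro w hw; rw [mem_LN] at hw; exact ⟨hw.2, ne_KL hx.1 hw.1⟩

lemma T_one (ho : IsOriented A) (hf : SFree A 3) {k l m : V} (hk : 1 ≤ (KN A k).card)
    (hl : l ∈ Lf A) (hm : m ∈ Lf A) (hlm : l ≠ m) (lk : A l k) (mk : A m k)
    (cl : 3 ≤ (inN A l).card) (cm : 3 ≤ (inN A m).card) : False := by
  classical
  obtain ⟨x, hx⟩ := Finset.card_pos.1 hk
  rw [mem_KN] at hx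
  have e1 := Finset.pred_card_le_card_erase (s := inN A l) (a := x)
  have e2 := Finset.pred_card_le_card_erase (s := inN A m) (a := x)
  refine noPair ho hf hx.1 hx.2 lk mk hlm (ne_KL hx.1 hl) (ne_KL hx.1 hm)
    (S := (inN A l).erase x) (T := (inN A m).erase x) ?_ ?_ (by omega) (by omega)
  · intro w hw; rw [mem_erase, mem_inN] at hw; exact ⟨hw.2, hw.1.symm⟩
  · intro w hw; rw [mem_erase, mem_inN] at hw; exact ⟨hw.2, hw.1.symm⟩

lemma K2_LN (ho : IsOriented A) (hf : SFree A 3) {k l : V} (hk : 2 ≤ (KN A k).card)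
    (hl : l ∈ Lf A) (lk : A l k) : LN A l = ∅ := by
  by_contra h
  obtain ⟨c, hc⟩ := Finset.nonempty_iff_ne_empty.2 h
  rw [mem_LN] at hc
  obtain ⟨x, hx, y, hy, xy⟩ := Finset.one_lt_card.1 hk
  rw [mem_KN] at hx hy
  exact noH2 ho hf hx.1 hy.1 xy hx.2 hy.2 lk hc.2 (ne_KL hx.1 hl) (ne_KL hx.1 hc.1)
    (ne_KL hy.1 hl) (ne_KL hy.1 hc.1)

open scoped Classical in
/-- Heavy vertices with two heavy in-neighbours. -/
noncomputable def K2 (A : V → V → Prop) : Finset V :=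
  (Kf A).filter (fun k => 2 ≤ (KN A k).card)

open scoped Classical in
/-- Heavy vertices with a heavy in-neighbour. -/
noncomputable def Kp (A : V → V → Prop) : Finset V :=
  (Kf A).filter (fun k => 1 ≤ (KN A k).card)

lemma mem_Kp {k : V} : k ∈ Kp A ↔ k ∈ Kf A ∧ 1 ≤ (KN A k).card := by simp [Kp]
lemma mem_K2 {k : V} : k ∈ K2 A ↔ k ∈ Kf A ∧ 2 ≤ (KN A k).card := by simp [K2]

lemma sum_KN (ho : IsOriented A) (hf : SFree A 3) :
    ∑ k ∈ Kf A, (KN A k).card ≤ (Kp A).card + (K2 A).card := by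
  classical
  have hs := sumb (Kf A) (fun k => (KN A k).card) 0 1 1 (fun _ => False)
      (fun k => 1 ≤ (KN A k).card) (fun k => 2 ≤ (KN A k).card) (by
    intro k _
    have := KN_le ho hf k
    simp only [if_false]
    split_ifs <;> omega)
  have e1 : ((Kf A).filter (fun k => 1 ≤ (KN A k).card)).card = (Kp A).card := by
    rfl
  have e2 : ((Kf A).filter (fun k => 2 ≤ (KN A k).card)).card = (K2 A).card := by
    rfl
  rw [e1, e2] at hs
  omega

lemma Kp_le : (Kp A).card ≤ (Kf A).card := Finset.card_le_card fun _ h => (mem_Kp.1 h).1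
lemma K2_le : (K2 A).card ≤ (Kp A).card := Finset.card_le_card fun _ h =>
  mem_Kp.2 ⟨(mem_K2.1 h).1, by have := (mem_K2.1 h).2; omega⟩

lemma LN_del (ho : IsOriented A) (hf : SFree A 3) {l : V} (hl : l ∈ Lf A)
    (h : 1 ≤ (LN A l).card) : del A l + (K2 A).card ≤ (Kf A).card := by
  classical
  unfold del
  rw [← Finset.card_union_of_disjoint]
  · apply Finset.card_le_card
    intro x; simp only [mem_union, mem_filter, mem_K2]; tauto
  · rw [Finset.disjoint_left]
    intro x hx hx'
    have := K2_LN ho hf (mem_K2.1 hx').2 hl (mem_filter.1 hx).2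
    simp [this] at h

/-- `Q` has at most four elements if there is a heavy vertex with a heavy in-neighbour. -/
lemma Q_le (ho : IsOriented A) (hf : SFree A 3) (hK : 11 ≤ (Kf A).card)
    (hp : 1 ≤ (Kp A).card) : (Qf A).card ≤ 4 := by
  classical
  by_contra hc
  obtain ⟨k0, hk0⟩ := Finset.card_pos.1 hp
  rw [mem_Kp] at hk0
  have h1 : ((Qf A).filter (fun l => A l k0)).card ≤ 1 := by
    rw [Finset.card_le_one]
    intro a ha b hb
    by_contra hab
    rw [mem_filter] at ha hb
    exact Q_one ho hf hk0.2 ha.1 hb.1 hab ha.2 hb.2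
  have h2 := Finset.card_filter_add_card_filter_not (s := Qf A) (fun l => A l k0)
  obtain ⟨F, hF, cF⟩ := Finset.exists_subset_card_eq
    (show 4 ≤ ((Qf A).filter (fun l => ¬ A l k0)).card by omega)
  have hFQ : ∀ l ∈ F, l ∈ Qf A ∧ ¬ A l k0 := fun l hl => mem_filter.1 (hF hl)
  obtain ⟨k, -, hk⟩ := common (A := A) (F := F) (S := Kf A) (c := 2) (Finset.Subset.refl _)
    (fun l hl => Q_del (hFQ l hl).1) (by omega)
  refine no4 ho hf cF.ge hk (fun l hl => ?_)
  have hv := (mem_Qf.1 (hFQ l hl).1).2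
  have hd : del A l < (Kf A).card := by
    apply Finset.card_lt_card
    rw [Finset.filter_ssubset]
    exact ⟨k0, hk0.1, (hFQ l hl).2⟩
  unfold val at hv
  omega

lemma Kp_small (ho : IsOriented A) (hf : SFree A 3) (hQ : 2 ≤ (Qf A).card) :
    (Kp A).card ≤ 4 := by
  classical
  by_contra hc
  obtain ⟨x, hx, y, hy, xy⟩ := Finset.one_lt_card.1 hQ
  have : ({x, y} : Finset V).card ≤ 2 := Finset.card_le_two
  obtain ⟨k, hk, hk'⟩ := common (A := A) (F := {x, y}) (S := Kp A) (c := 2)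
    (fun _ h => (mem_Kp.1 h).1)
    (by
      intro z hz
      simp only [mem_insert, mem_singleton] at hz
      rcases hz with rfl | rfl <;> apply Q_del <;> assumption)
    (by omega)
  exact Q_one ho hf (mem_Kp.1 hk).2 hx hy xy (hk' x (by simp)) (hk' y (by simp))

lemma fin_gen {n x y c a : ℕ} (h : a ≤ x * y + c) (hc : (x + y) ^ 2 + 4 * c ≤ (n + 2) ^ 2) :
    a ≤ (n + 2) ^ 2 / 4 := by
  rw [Nat.le_div_iff_mul_le (by norm_num)]
  have : 4 * (x * y) ≤ (x + y) ^ 2 := by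
    zify; nlinarith [sq_nonneg ((x : ℤ) - y)]
  nlinarith

lemma num1 {K L n a : ℕ} (h : K + L = n) (hn : 40 ≤ n) (hK : K ≤ 10)
    (ha : a ≤ L * (K + 4) + 2 * K) : a ≤ (n + 2) ^ 2 / 4 := by
  rw [Nat.le_div_iff_mul_le (by norm_num)]
  obtain ⟨m, hm⟩ : ∃ m, L = 40 - K + m := ⟨L - (40 - K), by omega⟩
  subst h
  subst hm
  clear hn
  interval_cases K <;> norm_num at ha ⊢ <;> nlinarith

lemma num2 {K L n a : ℕ} (h : K + L = n) (hn : 40 ≤ n) (hL : L ≤ 5)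
    (ha : a ≤ L * (K + 4) + 2 * K) : a ≤ (n + 2) ^ 2 / 4 := by
  rw [Nat.le_div_iff_mul_le (by norm_num)]
  obtain ⟨m, hm⟩ : ∃ m, K = 40 - L + m := ⟨K - (40 - L), by omega⟩
  subst h
  subst hm
  clear hn
  interval_cases L <;> norm_num at ha ⊢ <;> nlinarith

/-- Many vertices with exactly one heavy in-neighbour. -/
lemma last (ho : IsOriented A) (hf : SFree A 3) (hp : 15 ≤ (Kp A).card) (hL : 6 ≤ (Lf A).card)
    (hQ : (Qf A).card = 1) :
    2 ≤ ((Lf A).filter (fun l => val A l ≤ (Kf A).card)).card := by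
  classical
  by_contra hD
  set D := (Lf A).filter (fun l => val A l ≤ (Kf A).card) with hDdef
  obtain ⟨p, hpQ⟩ := Finset.card_eq_one.1 hQ
  have pQ : p ∈ Qf A := by simp [hpQ]
  have hpt := Q_LN ho pQ
  have pL := (mem_Qf.1 pQ).1
  have nd : ∀ l ∈ Lf A, l ∉ D → (1 ≤ (LN A l).card ∧ (Kf A).card ≤ del A l + 3) := by
    intro l hl hlD
    have : ¬ val A l ≤ (Kf A).card := fun h => hlD (mem_filter.2 ⟨hl, h⟩)
    have h1 := val_le ho l
    have h2 := val_del hl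
    omega
  obtain ⟨w, hw, hwD⟩ := pick (T := LN A p) (S := D) (c := 1) (by omega) hpt
  obtain ⟨w', hw', hn⟩ := pick (T := LN A p) (S := {w}) (c := 1) (by simp) hpt
  simp only [mem_singleton] at hn
  rw [mem_LN] at hw hw'
  obtain ⟨c, hc⟩ := Finset.card_pos.1 (nd w hw.1 hwD).1
  rw [mem_LN] at hc
  have cp : c ≠ p := by rintro rfl; exact ho _ _ hw.2 hc.2
  have cw := irr ho hc.2
  have wp := irr ho hw.2
  have w'p := irr ho hw'.2
  obtain ⟨l, hl, hln⟩ := pick (T := Lf A) (S := D ∪ {p, w, w', c}) (c := 5) (by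
    have h1 := Finset.card_union_le D {p, w, w', c}
    have h2 : ({p, w, w', c} : Finset V).card ≤ 4 := Finset.card_le_four
    omega) hL
  simp only [mem_union, mem_insert, mem_singleton, not_or] at hln
  obtain ⟨lD, lp, lw, lw', lc⟩ := hln
  obtain ⟨b, hb⟩ := Finset.card_pos.1 (nd l hl lD).1
  rw [mem_LN] at hb
  have c3 : ({p, w, l} : Finset V).card ≤ 3 := Finset.card_le_three
  obtain ⟨k, hk, hkF⟩ := common (A := A) (F := {p, w, l}) (S := Kp A) (c := 3)
    (fun _ h => (mem_Kp.1 h).1)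
    (by
      intro z hz
      simp only [mem_insert, mem_singleton] at hz
      rcases hz with rfl | rfl | rfl
      · have := Q_del pQ; omega
      · exact (nd _ hw.1 hwD).2
      · exact (nd _ hl lD).2)
    (by omega)
  have kp := hkF p (by simp)
  have kw := hkF w (by simp)
  have kl := hkF l (by simp)
  obtain ⟨x, hx⟩ := Finset.card_pos.1 (mem_Kp.1 hk).2
  rw [mem_KN] at hx
  have key : ∀ u1 u2 v1 v2, A u1 k → A u2 k → A v1 u1 → A v2 u2 → u1 ∈ Lf A → u2 ∈ Lf A →
      v1 ∈ Lf A → v2 ∈ Lf A → u1 ≠ u2 → v1 ≠ v2 → u1 ≠ v2 → u2 ≠ v1 → False := by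
    intro u1 u2 v1 v2 h1 h2 g1 g2 m1 m2 m3 m4 n1 n2 n3 n4
    exact noH1 ho hf hx.1 hx.2 h1 h2 g1 g2 n1 n2 n3 n4 (ne_KL hx.1 m1) (ne_KL hx.1 m2)
      (ne_KL hx.1 m3) (ne_KL hx.1 m4)
  by_cases hcw : c = w'
  · subst hcw
    by_cases hbc : b = c
    · subst hbc
      exact key l p b w kl kp hb.2 hw.2 hl pL hb.1 hw.1 lp cw lw cp.symm
    by_cases hbw : b = w
    · subst hbw
      exact key l p b c kl kp hb.2 hw'.2 hl pL hb.1 hw'.1 lp hbc lc wp.symm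
    exact key l w b c kl kw hb.2 hc.2 hl hw.1 hb.1 hc.1 lw hbc lc (Ne.symm hbw)
  · exact key w p c w' kw kp hc.2 hw'.2 hw.1 pL hc.1 hw'.1 wp hcw (Ne.symm hn) cp.symm

end S31

open S31 Finset in
set_option maxHeartbeats 1000000 in
theorem arc_bound_S31 {V : Type*} [Fintype V] (A : V → V → Prop)
    (n : ℕ) (hn : 40 ≤ n) (hcard : Fintype.card V = n)
    (hori : IsOriented A) (hfree : SFree A 3) :
    arcCount A ≤ (n + 2) ^ 2 / 4 := by
  classical
  have hKL := card_KL (A := A)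
  rw [hcard] at hKL
  have ha := arc_eq (A := A)
  have hsK := sum_KN hori hfree
  have hKp := Kp_le (A := A)
  have hK2 := K2_le (A := A)
  have hQR := sum_QR hori
  have hRQ := R_le_Q (A := A)
  have hb4 : ∑ l ∈ Lf A, val A l ≤ (Lf A).card * ((Kf A).card + 4) := by
    rw [← smul_eq_mul]
    apply Finset.sum_le_card_nsmul
    intro l hl
    have h1 := val_del hl
    have h2 := del_le (A := A) l
    omega
  -- many vertices with two heavy in-neighbours
  by_cases h24 : 4 ≤ (K2 A).card
  · have hb : ∑ l ∈ Lf A, val A l ≤ (Lf A).card * (Kf A).card := by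
      rw [← smul_eq_mul]
      apply Finset.sum_le_card_nsmul
      intro l hl
      have h1 := val_le hori l
      have h2 := val_del hl
      by_cases h : 1 ≤ (LN A l).card
      · have := LN_del hori hfree hl h
        omega
      · omega
    refine fin_gen (x := (Lf A).card + 2) (y := (Kf A).card) (c := 0) ?_ ?_
    · nlinarith
    · subst hKL; ring_nf; rfl
  have key1 : arcCount A ≤ (Lf A).card * ((Kf A).card + 1) + 20 → arcCount A ≤ (n + 2) ^ 2 / 4 := by
    intro h
    refine fin_gen h ?_
    subst hKL; nlinarith
  have hsmall : arcCount A ≤ (Lf A).card * ((Kf A).card + 4) + 2 * (Kf A).card := by omega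
  by_cases hK : 11 ≤ (Kf A).card
  swap
  · exact num1 hKL hn (by omega) hsmall
  by_cases hL : 6 ≤ (Lf A).card
  swap
  · exact num2 hKL hn (by omega) hsmall
  by_cases hκ : 1 ≤ (Kp A).card
  swap
  · by_cases hQ : 15 ≤ (Qf A).card
    · have := sum_large hori hfree hK hQ
      refine fin_gen (x := (Lf A).card) (y := (Kf A).card + 2) (c := 0) (by omega) ?_
      subst hKL; ring_nf; rfl
    · have := R_le hori hfree hK
      apply key1; omega
  have hQ4 := Q_le hori hfree hK hκ
  by_cases hQ2 : 2 ≤ (Qf A).card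
  · have := Kp_small hori hfree hQ2
    apply key1; omega
  by_cases hbig : (Kp A).card + (K2 A).card ≤ 17
  · apply key1; omega
  by_cases h22 : 2 ≤ (K2 A).card
  · -- at most one light vertex contributes more than `K`
    have h1 : ((Lf A).filter (fun l => (Kf A).card + 1 ≤ val A l)).card ≤ 1 := by
      rw [Finset.card_le_one]
      intro a ha b hb
      by_contra hab
      rw [mem_filter] at ha hb
      have aux : ∀ l, l ∈ Lf A → (Kf A).card + 1 ≤ val A l →
          3 ≤ (inN A l).card ∧ (Kf A).card ≤ del A l + 3 := by
        intro l hl hv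
        have h1 := val_le hori l
        have h2 := LN_del hori hfree hl (by omega)
        have h3 := light_le hl
        unfold S31.val at hv
        omega
      have ha' := aux a ha.1 ha.2
      have hb' := aux b hb.1 hb.2
      have c2 : ({a, b} : Finset V).card ≤ 2 := Finset.card_le_two
      obtain ⟨k, hk, hkF⟩ := common (A := A) (F := {a, b}) (S := Kp A) (c := 3)
        (fun _ h => (mem_Kp.1 h).1)
        (by
          intro z hz
          simp only [mem_insert, mem_singleton] at hz
          rcases hz with rfl | rfl
          · exact ha'.2
          · exact hb'.2)
        (by omega)
      exact T_one hori hfree (mem_Kp.1 hk).2 ha.1 hb.1 hab (hkF a (by simp)) (hkF b (by simp))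
        ha'.1 hb'.1
    have hs := sumb (Lf A) (val A) ((Kf A).card) 4 0 (fun _ => False)
        (fun l => (Kf A).card + 1 ≤ val A l) (fun _ => False) (by
      intro l hl
      have h1 := val_del hl
      have h2 := del_le (A := A) l
      simp only [if_false]
      split_ifs <;> omega)
    refine fin_gen (x := (Lf A).card + 1) (y := (Kf A).card) (c := 7) ?_ ?_
    · have : arcCount A ≤ (Lf A).card * (Kf A).card + 4 + (Kf A).card + 3 := by omega
      nlinarith
    · subst hKL; nlinarith
  by_cases hQ0 : (Qf A).card = 0
  · refine fin_gen (x := (Lf A).card + 1) (y := (Kf A).card + 1) (c := 0) ?_ ?_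
    · have : arcCount A ≤ (Lf A).card * ((Kf A).card + 1) + (Kf A).card + 1 := by omega
      nlinarith
    · subst hKL; ring_nf; rfl
  have hQ1 : (Qf A).card = 1 := by omega
  have hl := last hori hfree (by omega) hL hQ1
  have hs := sumb (Lf A) (val A) ((Kf A).card + 1) (3 - (K2 A).card) 0
      (fun l => val A l ≤ (Kf A).card)
      (fun l => (Kf A).card + 2 ≤ val A l) (fun _ => False) (by
    intro l hl
    have h1 := val_del hl
    have h2 := del_le (A := A) l
    have h3 := val_le hori l
    have h4 := LN_del hori hfree hl
    simp only [if_false]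
    split_ifs <;> omega)
  have e1 : ((Lf A).filter (fun l => (Kf A).card + 2 ≤ val A l)).card = (Qf A).card := by
    rfl
  rw [e1, hQ1] at hs
  refine fin_gen (x := (Lf A).card + 1) (y := (Kf A).card + 1) (c := 0) ?_ ?_
  · have : arcCount A ≤ (Lf A).card * ((Kf A).card + 1) + (Kf A).card + 1 := by omega
    nlinarith
  · subst hKL; ring_nf; rfl
end

section
/- For every integer n ≥ 40 there exists an S_{3,1}-free oriented graph on n vertices with exactly ⌊(n+2)²/4⌋ arcs; hence the oriented Turán number ex_ori(n, S_{3,1}) equals ⌊(n+2)²/4⌋. -/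
open Finset

/-- In-neighbour finset. -/
noncomputable def inN {V : Type*} [Fintype V] (A : V → V → Prop) (v : V) : Finset V := by
  classical exact univ.filter (fun u => A u v)

lemma mem_inN {V : Type*} [Fintype V] (A : V → V → Prop) (u v : V) :
    u ∈ inN A v ↔ A u v := by
  classical
  simp [inN]

lemma arcCount_eq {V : Type*} [Fintype V] (A : V → V → Prop) :
    arcCount A = ∑ v, (inN A v).card := by
  classical
  have h : {p : V × V | A p.1 p.2} =
      ((univ : Finset V).sigma (fun v => inN A v)).map
        ⟨fun p : (Σ _ : V, V) => (p.2, p.1), by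
          rintro ⟨a, b⟩ ⟨c, d⟩ h
          simp at h
          simp [h]⟩ := by
    ext ⟨a, b⟩
    simp only [Set.mem_setOf_eq, mem_coe, mem_map, mem_sigma, mem_univ, true_and, mem_inN]
    constructor
    · intro h
      exact ⟨⟨b, a⟩, h, rfl⟩
    · rintro ⟨⟨c, d⟩, h, h'⟩
      obtain ⟨rfl, rfl⟩ := Prod.mk.inj h'
      exact h
  rw [arcCount, h, Set.ncard_coe_finset, card_map, card_sigma]

lemma no_copy {V : Type*} {A : V → V → Prop} (hO : IsOriented A) (hS : SFree A 3)
    {v a b c x y z : V} (ha : A a v) (hb : A b v) (hc : A c v)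
    (hx : A x a) (hy : A y b) (hz : A z c)
    (hd : [a, b, c, x, y, z].Nodup) : False := by
  have irr : ∀ p, ¬ A p p := fun p h => hO p p h h
  simp at hd
  apply hS v
  refine ⟨![a, b, c], ![x, y, z], ?_, ?_, ?_, ?_, ?_, ?_, ?_⟩
  · intro i j h
    fin_cases i <;> fin_cases j <;> simp at h ⊢ <;> grind
  · intro i j h
    fin_cases i <;> fin_cases j <;> simp at h ⊢ <;> grind
  · intro i j
    fin_cases i <;> fin_cases j <;> simp <;> grind
  · intro i h
    fin_cases i <;> simp at h <;> subst h <;> exact irr _ (by assumption)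
  · intro i h
    fin_cases i <;> simp at h <;> subst h
    · exact hO _ _ ha hx
    · exact hO _ _ hb hy
    · exact hO _ _ hc hz
  · intro i
    fin_cases i <;> simpa
  · intro i
    fin_cases i <;> simpa

lemma exists_avoid {V : Type*} {S X : Finset V} (h : X.card < S.card) :
    ∃ w ∈ S, w ∉ X := exists_mem_notMem_of_card_lt_card h

lemma card4 {V : Type*} [DecidableEq V] (a b c d : V) :
    ({a, b, c, d} : Finset V).card < 5 := by
  have := card_le_four (a := a) (b := b) (c := c) (d := d)
  omega

/-- At most two in-neighbours have in-degree at least five. -/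
lemma two_big {V : Type*} [Fintype V] [DecidableEq V] {A : V → V → Prop}
    (hO : IsOriented A) (hS : SFree A 3) (v : V) :
    ((inN A v).filter (fun u => 5 ≤ (inN A u).card)).card ≤ 2 := by
  have irr : ∀ p, ¬ A p p := fun p h => hO p p h h
  by_contra hcon
  obtain ⟨a, b, c, ha, hb, hc, hab, hac, hbc⟩ := two_lt_card_iff.1 (not_le.1 hcon)
  simp only [mem_filter, mem_inN] at ha hb hc
  obtain ⟨x, hx, hx'⟩ := exists_avoid (lt_of_lt_of_le (card4 a b c c) ha.2)
  obtain ⟨y, hy, hy'⟩ := exists_avoid (lt_of_lt_of_le (card4 a b c x) hb.2)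
  have : ({a, b, x, y} : Finset V).card < _ := lt_of_lt_of_le (card4 a b x y) hc.2
  obtain ⟨z, hz, hz'⟩ := exists_avoid this
  rw [mem_inN] at hx hy hz
  have hzc : z ≠ c := fun h => irr c (h ▸ hz)
  refine no_copy hO hS ha.1 hb.1 hc.1 hx hy hz ?_
  simp at hx' hy' hz' ⊢
  grind

/-- An oriented set of arcs touching `z` with other endpoint in `T` has at most `|T|` elements. -/
lemma inc_card {V : Type*} [DecidableEq V] {P : Finset (V × V)}
    (hP : ∀ a b, (a, b) ∈ P → (b, a) ∉ P) (z : V) (T : Finset V) (S : Finset (V × V))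
    (hSP : S ⊆ P)
    (hT : ∀ a b, (a, b) ∈ S → (a = z ∧ b ∈ T) ∨ (b = z ∧ a ∈ T)) : S.card ≤ T.card := by
  apply card_le_card_of_injOn (fun p => if p.1 = z then p.2 else p.1)
  · rintro ⟨a, b⟩ h
    have h1 := hT a b h
    have h2 := hP a b (hSP h)
    have h3 := hSP h
    simp only [mem_coe]
    split_ifs <;> grind
  · rintro ⟨a, b⟩ h ⟨c, d⟩ h' heq
    have h1 := hT a b h
    have h2 := hP a b (hSP h)
    have h3 := hSP h
    have h1' := hT c d h'
    have h2' := hP c d (hSP h')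
    have h3' := hSP h'
    simp only at heq
    split_ifs at heq <;> grind

/-- Arcs of `P` touching `z`. -/
def inc {V : Type*} [DecidableEq V] (P : Finset (V × V)) (z : V) : Finset (V × V) :=
  P.filter (fun p => p.1 = z ∨ p.2 = z)

lemma inc_avoid {V : Type*} [DecidableEq V] {P : Finset (V × V)}
    (hP : ∀ a b, (a, b) ∈ P → (b, a) ∉ P) {z : V} (hz : 5 ≤ (inc P z).card)
    (a b c d : V) : ∃ w, ((w, z) ∈ P ∨ (z, w) ∈ P) ∧ w ≠ z ∧ w ≠ a ∧ w ≠ b ∧ w ≠ c ∧ w ≠ d := by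
  by_contra hcon
  have := inc_card hP z {a, b, c, d} (inc P z) (filter_subset _ _) (by
    intro p q hpq
    simp only [inc, mem_filter] at hpq
    have hne : p ≠ q := by
      rintro rfl
      exact hP _ _ hpq.1 hpq.1
    by_contra h
    apply hcon
    rcases hpq.2 with h1 | h1
    · subst h1
      refine ⟨q, Or.inr hpq.1, ?_⟩
      simp at h
      grind
    · subst h1
      refine ⟨p, Or.inl hpq.1, ?_⟩
      simp at h
      grind)
  have := card4 a b c d
  omega

lemma matching_struct {V : Type*} [DecidableEq V] {P : Finset (V × V)}
    (hP : ∀ a b, (a, b) ∈ P → (b, a) ∉ P)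
    (hM : ∀ a b c x y z, ((x, a) ∈ P ∨ (a, x) ∈ P) → ((y, b) ∈ P ∨ (b, y) ∈ P) →
      ((z, c) ∈ P ∨ (c, z) ∈ P) → [a, b, c, x, y, z].Nodup → False) :
    P.card ≤ 16 ∨ (∃ z, P.card ≤ (inc P z).card + 8) ∨
      (∃ z₁ z₂, z₁ ≠ z₂ ∧ ∀ a b, (a, b) ∈ P → a = z₁ ∨ b = z₁ ∨ a = z₂ ∨ b = z₂) := by
  have irr : ∀ a b, (a, b) ∈ P → a ≠ b := by
    rintro a b h rfl
    exact hP _ _ h h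
  by_cases h1 : ∃ z, 5 ≤ (inc P z).card
  · obtain ⟨z, hz⟩ := h1
    by_cases h2 : ∃ z', z' ≠ z ∧ 5 ≤ (inc P z').card
    · obtain ⟨z', hne, hz'⟩ := h2
      right; right
      refine ⟨z, z', hne.symm, ?_⟩
      intro a b hab
      by_contra hcon
      push Not at hcon
      obtain ⟨w, hw, hw'⟩ := inc_avoid hP hz z' a b b
      obtain ⟨y, hy, hy'⟩ := inc_avoid hP hz' z a b w
      have := irr _ _ hab
      refine hM z z' b w y a hw hy (Or.inl hab) ?_
      simp
      grind
    · right; left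
      refine ⟨z, ?_⟩
      push Not at h2
      by_cases h3 : ∃ a b, (a, b) ∈ P ∧ a ≠ z ∧ b ≠ z
      · obtain ⟨a, b, hab, ha, hb⟩ := h3
        have hsub : P ⊆ inc P z ∪ (inc P a ∪ inc P b) := by
          rintro ⟨c, d⟩ hcd
          by_contra hcon
          simp only [inc, mem_union, mem_filter] at hcon
          obtain ⟨w, hw, hw'⟩ := inc_avoid hP hz a b c d
          have := irr _ _ hab
          have := irr _ _ hcd
          refine hM z b d w a c hw (Or.inl hab) (Or.inl hcd) ?_
          simp
          grind
        have c1 := card_le_card hsub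
        have c2 := card_union_le (inc P z) (inc P a ∪ inc P b)
        have c3 := card_union_le (inc P a) (inc P b)
        have c4 := h2 a ha
        have c5 := h2 b hb
        omega
      · have hsub : P ⊆ inc P z := by
          rintro ⟨c, d⟩ hcd
          simp only [inc, mem_filter]
          grind
        have c1 := card_le_card hsub
        omega
  · left
    push Not at h1
    rcases P.eq_empty_or_nonempty with h0 | ⟨⟨a, b⟩, hab⟩
    · simp [h0]
    have c1 := h1 a
    have c2 := h1 b
    have c3 := card_union_le (inc P a) (inc P b)
    by_cases h3 : ∃ c d, (c, d) ∈ P ∧ c ≠ a ∧ c ≠ b ∧ d ≠ a ∧ d ≠ b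
    · obtain ⟨c, d, hcd, hh⟩ := h3
      have hsub : P ⊆ (inc P a ∪ inc P b) ∪ (inc P c ∪ inc P d) := by
        rintro ⟨e, f⟩ hef
        by_contra hcon
        simp only [inc, mem_union, mem_filter] at hcon
        have := irr _ _ hab
        have := irr _ _ hcd
        have := irr _ _ hef
        refine hM b d f a c e (Or.inl hab) (Or.inl hcd) (Or.inl hef) ?_
        simp
        grind
      have c4 := card_le_card hsub
      have c5 := card_union_le (inc P a ∪ inc P b) (inc P c ∪ inc P d)
      have c6 := card_union_le (inc P c) (inc P d)
      have c7 := h1 c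
      have c8 := h1 d
      omega
    · have hsub : P ⊆ inc P a ∪ inc P b := by
        rintro ⟨c, d⟩ hcd
        simp only [inc, mem_union, mem_filter]
        grind
      have c4 := card_le_card hsub
      omega

set_option maxHeartbeats 2000000 in
lemma key {V : Type*} [Fintype V] [DecidableEq V] {A : V → V → Prop}
    (hO : IsOriented A) (hS : SFree A 3) (D : ℕ) (hD : 11 ≤ D)
    (hmax : ∀ x, (inN A x).card ≤ D) (v : V) (hv : (inN A v).card = D)
    (he : D * (Fintype.card V - D) + 2 * D < ∑ x, (inN A x).card) :
    (∀ x, ¬ A x v → (inN A x).card = D) ∧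
    ∃ z₁ z₂, z₁ ≠ z₂ ∧ A z₁ v ∧ A z₂ v ∧
      (∀ u, A u v → u ≠ z₁ → u ≠ z₂ → ∀ w, A w u → w = z₁ ∨ w = z₂) ∧
      (∃ a, ¬ A a v ∧ A a z₁) ∧ (∃ a, ¬ A a v ∧ A a z₂) ∧
      (∃ u w, A u v ∧ u ≠ z₁ ∧ u ≠ z₂ ∧ A w u) := by
  classical
  have irr : ∀ p, ¬ A p p := fun p h => hO p p h h
  set N := inN A v with hN
  have memN : ∀ x, x ∈ N ↔ A x v := fun x => mem_inN A x v
  set P : Finset (V × V) := univ.filter (fun p : V × V => A p.1 p.2 ∧ A p.2 v) with hPdef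
  have memP : ∀ a b, (a, b) ∈ P ↔ A a b ∧ A b v := by
    intro a b
    simp [hPdef]
  have hP : ∀ a b, (a, b) ∈ P → (b, a) ∉ P := by
    intro a b h h'
    rw [memP] at h h'
    exact hO _ _ h.1 h'.1
  have hPcard : P.card = ∑ u ∈ N, (inN A u).card := by
    rw [← card_sigma]
    symm
    apply card_bij (fun (p : Σ _ : V, V) _ => (p.2, p.1))
    · rintro ⟨a, b⟩ h
      simp only [mem_sigma, mem_inN, hN] at h
      rw [memP]
      exact ⟨h.2, h.1⟩
    · rintro ⟨a, b⟩ _ ⟨c, d⟩ _ h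
      simp at h
      simp [h]
    · rintro ⟨a, b⟩ h
      rw [memP] at h
      exact ⟨⟨b, a⟩, by simp [hN, mem_inN, h], rfl⟩
  have hM : ∀ a b c x y z, ((x, a) ∈ P ∨ (a, x) ∈ P) → ((y, b) ∈ P ∨ (b, y) ∈ P) →
      ((z, c) ∈ P ∨ (c, z) ∈ P) → [a, b, c, x, y, z].Nodup → False := by
    intro a b c x y z h1 h2 h3 hd
    simp only [memP] at h1 h2 h3
    rcases h1 with h1 | h1 <;> rcases h2 with h2 | h2 <;> rcases h3 with h3 | h3 <;>
      refine no_copy hO hS h1.2 h2.2 h3.2 h1.1 h2.1 h3.1 ?_ <;> simp at hd ⊢ <;> grind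
  -- low vertices outside `N`
  set L := (Nᶜ).filter (fun x => (inN A x).card ≤ 4) with hL
  have hsplit : ∑ x, (inN A x).card = P.card + ∑ x ∈ Nᶜ, (inN A x).card := by
    rw [hPcard, sum_add_sum_compl]
  have hNc : (Nᶜ).card = Fintype.card V - D := by rw [card_compl, hv]
  have hout : ∑ x ∈ Nᶜ, (inN A x).card + 7 * L.card ≤ D * (Fintype.card V - D) := by
    have e1 : 7 * L.card = ∑ x ∈ Nᶜ, if (inN A x).card ≤ 4 then 7 else 0 := by
      rw [← sum_filter, sum_const, smul_eq_mul, mul_comm]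
    rw [e1, ← sum_add_distrib, ← hNc, mul_comm, ← smul_eq_mul]
    apply sum_le_card_nsmul
    intro x _
    have := hmax x
    split_ifs <;> omega
  have hgt : 2 * D + 7 * L.card < P.card := by omega
  -- in-neighbours of z outside N
  set Q : V → Finset V := fun z => (inN A z).filter (fun w => w ∉ N) with hQ
  have hQcard : ∀ z, (Q z).card ≤ 2 + L.card := by
    intro z
    have hsub : Q z ⊆ (inN A z).filter (fun u => 5 ≤ (inN A u).card) ∪ L := by
      intro w hw
      simp only [hQ, hL, mem_union, mem_filter, mem_compl] at hw ⊢
      by_cases h : 5 ≤ (inN A w).card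
      · exact Or.inl ⟨hw.1, h⟩
      · exact Or.inr ⟨hw.2, by omega⟩
    have c1 := card_le_card hsub
    have c2 := card_union_le ((inN A z).filter (fun u => 5 ≤ (inN A u).card)) L
    have c3 := two_big hO hS z
    omega
  have inc_out : ∀ z, z ∉ N → (inc P z).card ≤ D := by
    intro z hz
    rw [← hv]
    apply inc_card hP z N _ (filter_subset _ _)
    intro a b h
    simp only [inc, mem_filter, memP, memN] at h hz ⊢
    grind
  have inc_in : ∀ z, z ∈ N → (inc P z).card ≤ D - 1 + (Q z).card := by
    intro z hz
    have : (inc P z).card ≤ (N.erase z ∪ Q z).card := by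
      apply inc_card hP z _ _ (filter_subset _ _)
      intro a b h
      simp only [inc, mem_filter, memP, memN, hQ, mem_union, mem_erase, mem_inN] at h hz ⊢
      grind
    have c2 := card_union_le (N.erase z) (Q z)
    rw [card_erase_of_mem hz] at c2
    omega
  have inc_out' : ∀ z z', z ∉ N → z' ∈ N →
      ((inc P z).filter (fun p => p ∉ inc P z')).card ≤ D - 1 := by
    intro z z' hz hz'
    rw [← hv, ← card_erase_of_mem hz']
    apply inc_card hP z _ _ ((filter_subset _ _).trans (filter_subset _ _))
    intro a b h
    simp only [inc, mem_filter, memP, memN, mem_erase] at h hz hz' ⊢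
    grind
  have inc_in' : ∀ z z', z ∈ N → z' ∈ N → z ≠ z' →
      ((inc P z).filter (fun p => p ∉ inc P z')).card ≤ D - 2 + (Q z).card := by
    intro z z' hz hz' hne
    have : ((inc P z).filter (fun p => p ∉ inc P z')).card ≤
        ((N.erase z').erase z ∪ Q z).card := by
      apply inc_card hP z _ _ ((filter_subset _ _).trans (filter_subset _ _))
      intro a b h
      simp only [inc, mem_filter, memP, memN, hQ, mem_union, mem_erase, mem_inN] at h hz hz' ⊢
      grind
    have c2 := card_union_le ((N.erase z').erase z) (Q z)
    rw [card_erase_of_mem (mem_erase.2 ⟨hne, hz⟩), card_erase_of_mem hz'] at c2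
    omega
  rcases matching_struct hP hM with h | ⟨z, h⟩ | ⟨z₁, z₂, hne, hcov⟩
  · omega
  · exfalso
    by_cases hz : z ∈ N
    · have := inc_in z hz
      have := hQcard z
      omega
    · have := inc_out z hz
      omega
  · have hcard : ∀ z z', (∀ a b, (a, b) ∈ P → a = z ∨ b = z ∨ a = z' ∨ b = z') →
        P.card ≤ (inc P z).card + ((inc P z').filter (fun p => p ∉ inc P z)).card := by
      intro z z' hc
      refine le_trans (card_le_card ?_) (card_union_le _ _)
      rintro ⟨a, b⟩ hab
      have := hc a b hab
      simp only [inc, mem_union, mem_filter]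
      grind
    have k1 := hcard z₁ z₂ hcov
    have k2 := hcard z₂ z₁ (by intro a b h; have := hcov a b h; tauto)
    by_cases h1 : z₁ ∈ N <;> by_cases h2 : z₂ ∈ N
    · have a1 := inc_in z₁ h1
      have a2 := inc_in' z₂ z₁ h2 h1 hne.symm
      have b1 := hQcard z₁
      have b2 := hQcard z₂
      have hQ1 : 0 < (Q z₁).card := by omega
      have hQ2 : 0 < (Q z₂).card := by omega
      have hP1 : P.card ≤ 2 * D + 1 := by omega
      have hcov' : ∀ u, A u v → u ≠ z₁ → u ≠ z₂ → ∀ w, A w u → w = z₁ ∨ w = z₂ := by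
        intro u hu hu1 hu2 w hw
        have := hcov w u ((memP _ _).2 ⟨hw, hu⟩)
        tauto
      refine ⟨?_, z₁, z₂, hne, (memN _).1 h1, (memN _).1 h2, hcov', ?_, ?_, ?_⟩
      · intro x hx
        by_contra hcon
        have hlt : ∑ x ∈ Nᶜ, (inN A x).card < ∑ x ∈ Nᶜ, D := by
          apply sum_lt_sum (fun i _ => hmax i)
          refine ⟨x, ?_, lt_of_le_of_ne (hmax x) hcon⟩
          rw [mem_compl, memN]
          exact hx
        rw [sum_const, smul_eq_mul, hNc, mul_comm] at hlt
        omega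
      · obtain ⟨a, ha⟩ := card_pos.1 hQ1
        simp only [hQ, mem_filter, mem_inN, memN] at ha
        exact ⟨a, ha.2, ha.1⟩
      · obtain ⟨a, ha⟩ := card_pos.1 hQ2
        simp only [hQ, mem_filter, mem_inN, memN] at ha
        exact ⟨a, ha.2, ha.1⟩
      · by_contra hcon
        push Not at hcon
        have : P.card = (inN A z₁).card + (inN A z₂).card := by
          rw [hPcard, ← sum_pair hne (f := fun u => (inN A u).card)]
          symm
          apply sum_subset
          · intro x hx
            simp only [mem_insert, mem_singleton] at hx
            rcases hx with rfl | rfl <;> assumption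
          · intro x hx hx'
            simp only [mem_insert, mem_singleton, not_or] at hx'
            rw [card_eq_zero, eq_empty_iff_forall_notMem]
            intro w hw
            exact hcon x w ((memN _).1 hx) hx'.1 hx'.2 ((mem_inN _ _ _).1 hw)
        have := hmax z₁
        have := hmax z₂
        omega
    · exfalso
      have a1 := inc_in z₁ h1
      have a2 := inc_out' z₂ z₁ h2 h1
      have b1 := hQcard z₁
      omega
    · exfalso
      have a1 := inc_in z₂ h2
      have a2 := inc_out' z₁ z₂ h1 h2
      have b1 := hQcard z₂
      omega
    · exfalso
      have a1 := inc_out z₁ h1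
      have a2 := inc_out z₂ h2
      have a3 := card_le_card (filter_subset (fun p => p ∉ inc P z₁) (inc P z₂))
      omega

lemma final_contra {V : Type*} [Fintype V] [DecidableEq V] {A : V → V → Prop}
    (hO : IsOriented A) (hS : SFree A 3) (D : ℕ) (hD : 11 ≤ D)
    (hmax : ∀ x, (inN A x).card ≤ D) (v : V) (hv : (inN A v).card = D)
    (he : D * (Fintype.card V - D) + 2 * D < ∑ x, (inN A x).card)
    (hall : ∀ x, ¬ A x v → (inN A x).card = D)
    (z z' : V) (hne : z ≠ z') (hz : A z v) (hz' : A z' v)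
    (hcov : ∀ u, A u v → u ≠ z → u ≠ z' → ∀ w, A w u → w = z ∨ w = z')
    (ha : ∃ a, ¬ A a v ∧ A a z) (ha' : ∃ a, ¬ A a v ∧ A a z')
    (u : V) (hu : A u v) (huz : u ≠ z) (huz' : u ≠ z') (hzu : A z u) : False := by
  have key' := fun x hx => (key hO hS D hD hmax x hx he).1
  obtain ⟨a, hav, haz⟩ := ha
  obtain ⟨a', hav', haz'⟩ := ha'
  have hza := key' a (hall a hav) z (hO _ _ haz)
  have hza' := key' a' (hall a' hav') z' (hO _ _ haz')
  have hlow : ∀ t, A t v → t ≠ z → t ≠ z' → (inN A t).card ≤ 2 := by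
    intro t ht h1 h2
    refine le_trans (card_le_card (t := {z, z'}) ?_) card_le_two
    intro w hw
    have := hcov t ht h1 h2 w ((mem_inN _ _ _).1 hw)
    simpa using this
  set L := ((inN A v).erase z).erase z' with hL
  have hLcard : L.card = D - 2 := by
    rw [hL, card_erase_of_mem, card_erase_of_mem, hv]
    · omega
    · rwa [mem_inN]
    · rw [mem_erase, mem_inN]
      exact ⟨hne.symm, hz'⟩
  have hLa : ∀ t ∈ L, A t a := by
    intro t ht
    simp only [hL, mem_erase, mem_inN] at ht
    by_contra h
    have h1 := key' a (hall a hav) t h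
    have h2 := hlow t ht.2.2 ht.2.1 ht.1
    omega
  have h2 : 1 < (inN A a \ L).card := by
    have h3 := le_card_sdiff L (inN A a)
    have := hall a hav
    omega
  obtain ⟨g, hg, h, hh, hgh⟩ := one_lt_card.1 h2
  have big : ∀ t, t ∉ L → (inN A t).card = D := by
    intro t ht
    by_cases h1 : A t v
    · simp only [hL, mem_erase, mem_inN] at ht
      by_cases h3 : t = z
      · rw [h3]; exact hza
      · by_cases h4 : t = z'
        · rw [h4]; exact hza'
        · exact absurd ⟨h4, h3, h1⟩ ht
    · exact hall t h1
  have huL : u ∈ L := by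
    simp only [hL, mem_erase, mem_inN]
    exact ⟨huz', huz, hu⟩
  simp only [mem_sdiff, mem_inN] at hg hh
  have irr : ∀ p, ¬ A p p := fun p h => hO p p h h
  have hgz : g ≠ z := by
    rintro rfl
    exact hO _ _ haz hg.1
  have hhz : h ≠ z := by
    rintro rfl
    exact hO _ _ haz hh.1
  have hgu : g ≠ u := by
    rintro rfl
    exact hg.2 huL
  have hhu : h ≠ u := by
    rintro rfl
    exact hh.2 huL
  have bg := big g hg.2
  have bh := big h hh.2
  obtain ⟨x, hx, hx'⟩ := exists_avoid (S := inN A g) (lt_of_lt_of_le (card4 z u h h) (by omega))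
  obtain ⟨y, hy, hy'⟩ := exists_avoid (S := inN A h) (lt_of_lt_of_le (card4 z u g x) (by omega))
  rw [mem_inN] at hx hy
  have hxg : x ≠ g := fun h => irr g (h ▸ hx)
  have hyh : y ≠ h := fun h' => irr h (h' ▸ hy)
  refine no_copy hO hS (hLa u huL) hg.1 hh.1 hzu hx hy ?_
  simp at hx' hy' ⊢
  grind

lemma quad (n D : ℕ) (h : D ≤ n) : D * (n - D) + 2 * D ≤ (n + 2) ^ 2 / 4 := by
  rw [Nat.le_div_iff_mul_le (by norm_num)]
  obtain ⟨k, rfl⟩ := Nat.exists_eq_add_of_le h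
  rw [Nat.add_sub_cancel_left]
  zify
  nlinarith [sq_nonneg ((D : ℤ) - k - 2)]

lemma upper (n : ℕ) (hn : 40 ≤ n) (A : Fin n → Fin n → Prop)
    (hO : IsOriented A) (hS : SFree A 3) : arcCount A ≤ (n + 2) ^ 2 / 4 := by
  classical
  rw [arcCount_eq]
  by_contra hcon
  push Not at hcon
  obtain ⟨v, -, hv⟩ := exists_max_image (univ : Finset (Fin n)) (fun x => (inN A x).card)
    ⟨⟨0, by omega⟩, mem_univ _⟩
  have hmax : ∀ x, (inN A x).card ≤ (inN A v).card := fun x => hv x (mem_univ _)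
  have hDn : (inN A v).card ≤ n := by
    simpa using card_le_univ (inN A v)
  have hsum : ∑ x, (inN A x).card ≤ n * (inN A v).card := by
    simpa using sum_le_card_nsmul univ (fun x => (inN A x).card) _ (fun x _ => hmax x)
  have hD : 11 ≤ (inN A v).card := by
    by_contra hlt
    have h1 : n * (inN A v).card ≤ n * 10 := Nat.mul_le_mul_left _ (by omega)
    have h2 : n * 10 ≤ (n + 2) ^ 2 / 4 := by
      rw [Nat.le_div_iff_mul_le (by norm_num)]
      nlinarith
    omega
  have he : (inN A v).card * (Fintype.card (Fin n) - (inN A v).card) + 2 * (inN A v).card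
      < ∑ x, (inN A x).card := by
    rw [Fintype.card_fin]
    exact lt_of_le_of_lt (quad n _ hDn) hcon
  obtain ⟨hall, z₁, z₂, hne, h1, h2, hcov, ha1, ha2, u, w, hu, hu1, hu2, hw⟩ :=
    key hO hS _ hD hmax v rfl he
  rcases hcov u hu hu1 hu2 w hw with rfl | rfl
  · exact final_contra hO hS _ hD hmax v rfl he hall w z₂ hne h1 h2 hcov ha1 ha2 u hu hu1 hu2 hw
  · exact final_contra hO hS _ hD hmax v rfl he hall w z₁ hne.symm h2 h1
      (fun u a b c w d => (hcov u a c b w d).symm) ha2 ha1 u hu hu2 hu1 hw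

lemma lower (n : ℕ) (hn : 40 ≤ n) : ∃ A : Fin n → Fin n → Prop,
    IsOriented A ∧ SFree A 3 ∧ arcCount A = (n + 2) ^ 2 / 4 := by
  classical
  obtain ⟨m, hm⟩ : ∃ m, m = (n + 2) / 2 := ⟨_, rfl⟩
  refine ⟨fun i j => j.1 < m ∧ (m ≤ i.1 ∨ i.1 + 1 = j.1 ∨ i.1 + 2 = j.1 ∨
    (i.1 < m ∧ (i.1 + 1 = j.1 + m ∨ i.1 + 2 = j.1 + m))), ?_, ?_, ?_⟩
  · intro i j h1 h2
    omega
  · rintro v ⟨u, w, hu, -, -, -, -, h1, h2⟩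
    have a0 := (h1 0).1
    have a1 := (h1 1).1
    have a2 := (h1 2).1
    have b0 := h2 0
    have b1 := h2 1
    have b2 := h2 2
    have c1 : (u 0).1 ≠ (u 1).1 := fun h => by simpa using hu (Fin.ext h)
    have c2 : (u 0).1 ≠ (u 2).1 := fun h => by simpa using hu (Fin.ext h)
    have c3 : (u 1).1 ≠ (u 2).1 := fun h => by simpa using hu (Fin.ext h)
    omega
  · rw [arcCount_eq]
    have hdeg : ∀ j : Fin n, (inN (fun i j : Fin n => j.1 < m ∧ (m ≤ i.1 ∨ i.1 + 1 = j.1 ∨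
        i.1 + 2 = j.1 ∨ (i.1 < m ∧ (i.1 + 1 = j.1 + m ∨ i.1 + 2 = j.1 + m)))) j).card =
        if j.1 < m then n - m + 2 else 0 := by
      intro j
      split_ifs with hj
      · have hp : ∃ p : Fin n, p.1 < m ∧ (p.1 + 1 = j.1 ∨ p.1 + 1 = j.1 + m) := by
          by_cases h : 1 ≤ j.1
          · exact ⟨⟨j.1 - 1, by omega⟩, by simp only; omega⟩
          · exact ⟨⟨j.1 + m - 1, by omega⟩, by simp only; omega⟩
        have hq : ∃ p : Fin n, p.1 < m ∧ (p.1 + 2 = j.1 ∨ p.1 + 2 = j.1 + m) := by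
          by_cases h : 2 ≤ j.1
          · exact ⟨⟨j.1 - 2, by omega⟩, by simp only; omega⟩
          · exact ⟨⟨j.1 + m - 2, by omega⟩, by simp only; omega⟩
        obtain ⟨p, hp1, hp2⟩ := hp
        obtain ⟨q, hq1, hq2⟩ := hq
        have hpq : p ≠ q := by
          intro h
          have := congrArg Fin.val h
          omega
        have hset : inN (fun i j : Fin n => j.1 < m ∧ (m ≤ i.1 ∨ i.1 + 1 = j.1 ∨
            i.1 + 2 = j.1 ∨ (i.1 < m ∧ (i.1 + 1 = j.1 + m ∨ i.1 + 2 = j.1 + m)))) j =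
            Finset.Ici (⟨m, by omega⟩ : Fin n) ∪ {p, q} := by
          ext i
          simp only [mem_inN, mem_union, Finset.mem_Ici, mem_insert, mem_singleton, Fin.ext_iff,
            Fin.le_def]
          omega
        rw [hset, card_union_of_disjoint, Fin.card_Ici, card_pair hpq]
        rw [disjoint_left]
        intro i hi
        simp only [Finset.mem_Ici, mem_insert, mem_singleton, Fin.ext_iff, Fin.le_def] at hi ⊢
        omega
      · rw [card_eq_zero, eq_empty_iff_forall_notMem]
        intro i hi
        rw [mem_inN] at hi
        exact hj hi.1
    rw [sum_congr rfl (fun j _ => hdeg j), ← sum_filter, sum_const, smul_eq_mul]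
    have hc : (univ.filter (fun j : Fin n => j.1 < m)).card = m := by
      rw [Fin.card_filter_val_lt]
      omega
    rw [hc]
    symm
    rcases Nat.even_or_odd' n with ⟨k, hk | hk⟩
    · have : m = k + 1 := by omega
      rw [this, hk]
      have h2 : 2 * k - (k + 1) + 2 = k + 1 := by omega
      rw [h2]
      apply Nat.div_eq_of_lt_le <;> nlinarith
    · have : m = k + 1 := by omega
      rw [this, hk]
      have h2 : 2 * k + 1 - (k + 1) + 2 = k + 2 := by omega
      rw [h2]
      apply Nat.div_eq_of_lt_le <;> nlinarith

/-- For every `n ≥ 40` there is an `S_{3,1}`-free oriented graph on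
`n` vertices with exactly `⌊(n+2)²/4⌋` arcs; hence `ex_ori(n, S_{3,1}) = ⌊(n+2)²/4⌋`. -/
theorem exOri_S31 (n : ℕ) (hn : 40 ≤ n) :
    (∃ A : Fin n → Fin n → Prop,
        IsOriented A ∧ SFree A 3 ∧ arcCount A = (n + 2) ^ 2 / 4) ∧
    (∀ A : Fin n → Fin n → Prop,
        IsOriented A → SFree A 3 → arcCount A ≤ (n + 2) ^ 2 / 4) := by
  exact ⟨lower n hn, fun A hO hS => upper n hn A hO hS⟩
end
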